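/- Let v₁, …, v₁₂ ∈ ℂ³ be a realisation of the 3×4 grid matroid G³₄, i.e. a triple of the vectors is linearly dependent exactly when its index set is contained in one of the seven lines {1,2,3}, {4,5,6}, {7,8,9}, {10,11,12}, {1,4,7,10}, {2,5,8,11}, {3,6,9,12} (and every pair is independent). Then for every column c_i (i = 1,2,3,4) and all P¹, …, P⁶ ∈ ℂ³, the grid polynomial G³₄(c_i; P¹,…,P⁶) vanishes. In particular, for c₁: [1 4 P¹][2 8 P²][3 12 P³][5 6 P⁴][7 9 P⁵][10 11 P⁶] + [1 7 P¹][2 11 P²][3 6 P³][4 5 P⁴][8 9 P⁵][10 12 P⁶] + [1 10 P¹][2 5 P²][3 9 P³][4 6 P⁴][7 8 P⁵][11 12 P⁶] − [1 4 P¹][2 11 P²][3 9 P³][5 6 P⁴][7 8 P⁵][10 12 P⁶] − [1 7 P¹][2 5 P²][3 12 P³][4 6 P⁴][8 9 P⁵][10 11 P⁶] − [1 10 P¹][2 8 P²][3 6 P³][4 5 P⁴][7 9 P⁵][11 12 P⁶] = 0, where [a b P] = det(v_a, v_b, P). -/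

import Mathlib

/-- The determinant of the 3×3 matrix with rows `u`, `v`, `w`. -/
noncomputable def det3 (u v w : Fin 3 → ℂ) : ℂ := Matrix.det (Matrix.of ![u, v, w])

/-- The point of the 3×4 grid in row `r` and column `c` (zero-indexed; the paper's
numbering is `p(r,c) = 3(c−1)+r` with `1`-based indices). -/
def gridPt (r : Fin 3) (c : Fin 4) : Fin 12 :=
  ⟨3 * c.val + r.val, by have := c.isLt; have := r.isLt; omega⟩

/-- The three columns other than `i`, in increasing order. -/
def otherCols (i : Fin 4) (m : Fin 3) : Fin 4 :=
  if (m : ℕ) < (i : ℕ) then ⟨m, by have := m.isLt; omega⟩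
  else ⟨m + 1, by have := m.isLt; omega⟩

/-- The two rows other than `j`, in increasing order. -/
def otherRows (j : Fin 3) (m : Fin 2) : Fin 3 :=
  if (m : ℕ) < (j : ℕ) then ⟨m, by have := m.isLt; omega⟩
  else ⟨m + 1, by have := m.isLt; omega⟩

/-- The seven lines of the 3×4 grid on points `0,…,11` (written `1,…,12` in the paper):
the four columns and the three rows. -/
def gridLines : Finset (Finset (Fin 12)) :=
  {{0, 1, 2}, {3, 4, 5}, {6, 7, 8}, {9, 10, 11},
   {0, 3, 6, 9}, {1, 4, 7, 10}, {2, 5, 8, 11}}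

/-- The grid polynomial `G³₄(cᵢ; P¹,…,P⁶)` for the column `cᵢ` of the 3×4 grid:
`Σ_{σ ∈ S₃} sgn(σ) Π_j [p(j,i) p(j,k_{σ(j)}) P^j] Π_m [q_m q'_m P^{3+m}]`, where
`k₁<k₂<k₃` are the remaining columns and `q_m, q'_m` are the two points of column
`k_m` in the rows other than `σ⁻¹(m)`. -/
noncomputable def G34 (v : Fin 12 → Fin 3 → ℂ) (i : Fin 4) (P : Fin 6 → Fin 3 → ℂ) : ℂ :=
  ∑ σ : Equiv.Perm (Fin 3),
    ((Equiv.Perm.sign σ : ℤ) : ℂ) *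
      ((∏ j : Fin 3,
          det3 (v (gridPt j i)) (v (gridPt j (otherCols i (σ j))))
            (P ⟨j.val, by have := j.isLt; omega⟩)) *
       (∏ m : Fin 3,
          det3 (v (gridPt (otherRows (σ⁻¹ m) 0) (otherCols i m)))
            (v (gridPt (otherRows (σ⁻¹ m) 1) (otherCols i m)))
            (P ⟨3 + m.val, by have := m.isLt; omega⟩)))

/-- The explicit grid polynomial for the first column `c₁` (paper's 1-based points
`1,…,12` correspond to indices `0,…,11`). -/
noncomputable def G34c1 (v : Fin 12 → Fin 3 → ℂ) (P : Fin 6 → Fin 3 → ℂ) : ℂ :=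
  det3 (v 0) (v 3) (P 0) * det3 (v 1) (v 7) (P 1) * det3 (v 2) (v 11) (P 2) *
      det3 (v 4) (v 5) (P 3) * det3 (v 6) (v 8) (P 4) * det3 (v 9) (v 10) (P 5) +
    det3 (v 0) (v 6) (P 0) * det3 (v 1) (v 10) (P 1) * det3 (v 2) (v 5) (P 2) *
      det3 (v 3) (v 4) (P 3) * det3 (v 7) (v 8) (P 4) * det3 (v 9) (v 11) (P 5) +
    det3 (v 0) (v 9) (P 0) * det3 (v 1) (v 4) (P 1) * det3 (v 2) (v 8) (P 2) *
      det3 (v 3) (v 5) (P 3) * det3 (v 6) (v 7) (P 4) * det3 (v 10) (v 11) (P 5) -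
    det3 (v 0) (v 3) (P 0) * det3 (v 1) (v 10) (P 1) * det3 (v 2) (v 8) (P 2) *
      det3 (v 4) (v 5) (P 3) * det3 (v 6) (v 7) (P 4) * det3 (v 9) (v 11) (P 5) -
    det3 (v 0) (v 6) (P 0) * det3 (v 1) (v 4) (P 1) * det3 (v 2) (v 11) (P 2) *
      det3 (v 3) (v 5) (P 3) * det3 (v 7) (v 8) (P 4) * det3 (v 9) (v 10) (P 5) -
    det3 (v 0) (v 9) (P 0) * det3 (v 1) (v 7) (P 1) * det3 (v 2) (v 5) (P 2) *
      det3 (v 3) (v 4) (P 3) * det3 (v 6) (v 8) (P 4) * det3 (v 10) (v 11) (P 5)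

theorem det3_eq (u v w : Fin 3 → ℂ) :
    det3 u v w = u 0 * v 1 * w 2 - u 0 * v 2 * w 1 - u 1 * v 0 * w 2 + u 1 * v 2 * w 0 +
      u 2 * v 0 * w 1 - u 2 * v 1 * w 0 := by
  simp [det3, Matrix.det_fin_three]

/-- Cramer's rule for four vectors, evaluated on the functional `det3 a b`. -/
theorem det3_cramer (a b x y z p : Fin 3 → ℂ) :
    det3 y z p * det3 a b x - det3 x z p * det3 a b y + det3 x y p * det3 a b z =
      det3 x y z * det3 a b p := by
  simp only [det3_eq]
  ring

theorem det3_ne_zero_iff (u v w : Fin 3 → ℂ) :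
    det3 u v w ≠ 0 ↔ LinearIndependent ℂ ![u, v, w] := by
  rw [det3, ← isUnit_iff_ne_zero, ← Matrix.isUnit_iff_isUnit_det,
    ← Matrix.linearIndependent_rows_iff_isUnit]
  rfl

/-- The matrix whose determinant is the grid polynomial. -/
noncomputable def gridMatrix (v : Fin 12 → Fin 3 → ℂ) (i : Fin 4) (P : Fin 6 → Fin 3 → ℂ) :
    Matrix (Fin 3) (Fin 3) ℂ :=
  Matrix.of fun j m =>
    det3 (v (gridPt j i)) (v (gridPt j (otherCols i m))) (P ⟨j.val, by omega⟩) *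
      det3 (v (gridPt (otherRows j 0) (otherCols i m)))
        (v (gridPt (otherRows j 1) (otherCols i m))) (P ⟨3 + m.val, by omega⟩)

theorem G34_eq_det (v : Fin 12 → Fin 3 → ℂ) (i : Fin 4) (P : Fin 6 → Fin 3 → ℂ) :
    G34 v i P = (gridMatrix v i P).det := by
  rw [← Matrix.det_transpose, Matrix.det_apply', G34]
  refine Finset.sum_congr rfl fun σ _ => ?_
  congr 1
  simp only [gridMatrix, Matrix.transpose_apply, Matrix.of_apply, Finset.prod_mul_distrib]
  congr 1
  refine (Equiv.prod_comp σ _).symm.trans (Finset.prod_congr rfl fun j _ => ?_)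
  simp

theorem G34c1_eq_G34 (v : Fin 12 → Fin 3 → ℂ) (P : Fin 6 → Fin 3 → ℂ) :
    G34c1 v P = G34 v 0 P := by
  rw [G34_eq_det, Matrix.det_fin_three]
  simp only [gridMatrix, Matrix.of_apply]
  change G34c1 v P =
    det3 (v 0) (v 3) (P 0) * det3 (v 4) (v 5) (P 3) *
      (det3 (v 1) (v 7) (P 1) * det3 (v 6) (v 8) (P 4)) *
      (det3 (v 2) (v 11) (P 2) * det3 (v 9) (v 10) (P 5)) -
    det3 (v 0) (v 3) (P 0) * det3 (v 4) (v 5) (P 3) *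
      (det3 (v 1) (v 10) (P 1) * det3 (v 9) (v 11) (P 5)) *
      (det3 (v 2) (v 8) (P 2) * det3 (v 6) (v 7) (P 4)) -
    det3 (v 0) (v 6) (P 0) * det3 (v 7) (v 8) (P 4) *
      (det3 (v 1) (v 4) (P 1) * det3 (v 3) (v 5) (P 3)) *
      (det3 (v 2) (v 11) (P 2) * det3 (v 9) (v 10) (P 5)) +
    det3 (v 0) (v 6) (P 0) * det3 (v 7) (v 8) (P 4) *
      (det3 (v 1) (v 10) (P 1) * det3 (v 9) (v 11) (P 5)) *
      (det3 (v 2) (v 5) (P 2) * det3 (v 3) (v 4) (P 3)) +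
    det3 (v 0) (v 9) (P 0) * det3 (v 10) (v 11) (P 5) *
      (det3 (v 1) (v 4) (P 1) * det3 (v 3) (v 5) (P 3)) *
      (det3 (v 2) (v 8) (P 2) * det3 (v 6) (v 7) (P 4)) -
    det3 (v 0) (v 9) (P 0) * det3 (v 10) (v 11) (P 5) *
      (det3 (v 1) (v 7) (P 1) * det3 (v 6) (v 8) (P 4)) *
      (det3 (v 2) (v 5) (P 2) * det3 (v 3) (v 4) (P 3))
  rw [G34c1]
  ring

/-- The grid polynomial for `cᵢ` vanishes as soon as the columns and rows are collinear and the
line through the first two points of `cᵢ` misses the points of another column. -/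
theorem G34_eq_zero (v : Fin 12 → Fin 3 → ℂ) (i : Fin 4) (P : Fin 6 → Fin 3 → ℂ)
    (hcol : ∀ c, det3 (v (gridPt 0 c)) (v (gridPt 1 c)) (v (gridPt 2 c)) = 0)
    (hrow : ∀ r c c' c'', det3 (v (gridPt r c)) (v (gridPt r c')) (v (gridPt r c'')) = 0)
    (hne : ∀ r, det3 (v (gridPt 0 i)) (v (gridPt 1 i)) (v (gridPt r (otherCols i 0))) ≠ 0) :
    G34 v i P = 0 := by
  set f := det3 (v (gridPt 0 i)) (v (gridPt 1 i)) with hf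
  have hfi : ∀ r, f (v (gridPt r i)) = 0 := by
    rw [Fin.forall_fin_succ, Fin.forall_fin_two]
    refine ⟨?_, ?_, hcol i⟩
    · simp only [hf, det3_eq]; ring
    · simp only [hf, det3_eq, Fin.succ_zero_eq_one]; ring
  let A : Fin 3 → ℂ := fun j =>
    det3 (v (gridPt j i)) (v (gridPt j (otherCols i 0))) (P ⟨j.val, by omega⟩) /
      f (v (gridPt j (otherCols i 0)))
  let N : Matrix (Fin 3) (Fin 3) ℂ := Matrix.of fun j m =>
    f (v (gridPt j (otherCols i m))) *
      det3 (v (gridPt (otherRows j 0) (otherCols i m)))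
        (v (gridPt (otherRows j 1) (otherCols i m))) (P ⟨3 + m.val, by omega⟩)
  have hM : gridMatrix v i P = Matrix.diagonal A * N := by
    ext j m
    have h : det3 (v (gridPt j i)) (v (gridPt j (otherCols i m))) (P ⟨j.val, by omega⟩) =
        A j * f (v (gridPt j (otherCols i m))) := by
      rw [div_mul_eq_mul_div, eq_div_iff (hne j)]
      have h := det3_cramer (v (gridPt 0 i)) (v (gridPt 1 i)) (v (gridPt j i))
        (v (gridPt j (otherCols i 0))) (v (gridPt j (otherCols i m))) (P ⟨j.val, by omega⟩)
      rw [← hf, hrow, hfi] at h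
      linear_combination -h
    simp only [gridMatrix, N, Matrix.diagonal_mul, Matrix.of_apply, h, mul_assoc]
  have hN : N.det = 0 := by
    refine Matrix.exists_vecMul_eq_zero_iff.mp ⟨![1, -1, 1], fun h => ?_, ?_⟩
    · simpa using congrFun h 0
    · ext m
      have h := det3_cramer (v (gridPt 0 i)) (v (gridPt 1 i)) (v (gridPt 0 (otherCols i m)))
        (v (gridPt 1 (otherCols i m))) (v (gridPt 2 (otherCols i m))) (P ⟨3 + m.val, by omega⟩)
      rw [← hf, hcol, zero_mul] at h
      simp only [Matrix.vecMul, dotProduct, Fin.sum_univ_three, N, Matrix.of_apply,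
        Matrix.cons_val, Pi.zero_apply]
      have e00 : otherRows 0 0 = 1 := rfl
      have e01 : otherRows 0 1 = 2 := rfl
      have e10 : otherRows 1 0 = 0 := rfl
      have e11 : otherRows 1 1 = 2 := rfl
      have e20 : otherRows 2 0 = 0 := rfl
      have e21 : otherRows 2 1 = 1 := rfl
      rw [e00, e01, e10, e11, e20, e21]
      linear_combination h
  rw [G34_eq_det, hM, Matrix.det_mul, hN, mul_zero]

/-- If `v₁,…,v₁₂ ∈ ℂ³` is a realisation of the 3×4 grid matroid, then for every column
`cᵢ` and all `P¹,…,P⁶ ∈ ℂ³` the grid polynomial `G³₄(cᵢ; P¹,…,P⁶)` vanishes; in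
particular the explicit polynomial for `c₁` vanishes. -/
theorem stmt15 (v : Fin 12 → Fin 3 → ℂ)
    (htriples : ∀ a b c : Fin 12, a ≠ b → a ≠ c → b ≠ c →
      (¬ LinearIndependent ℂ ![v a, v b, v c] ↔
        ∃ ℓ ∈ gridLines, ({a, b, c} : Finset (Fin 12)) ⊆ ℓ))
    (hpairs : ∀ a b : Fin 12, a ≠ b → LinearIndependent ℂ ![v a, v b]) :
    (∀ i : Fin 4, ∀ P : Fin 6 → Fin 3 → ℂ, G34 v i P = 0) ∧
    (∀ P : Fin 6 → Fin 3 → ℂ, G34c1 v P = 0) := by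
  have hline : ∀ a b c : Fin 12, (∃ ℓ ∈ gridLines, ({a, b, c} : Finset (Fin 12)) ⊆ ℓ) →
      det3 (v a) (v b) (v c) = 0 := by
    intro a b c h
    by_cases hab : a = b
    · subst hab; simp only [det3_eq]; ring
    by_cases hac : a = c
    · subst hac; simp only [det3_eq]; ring
    by_cases hbc : b = c
    · subst hbc; simp only [det3_eq]; ring
    by_contra hd
    exact (htriples a b c hab hac hbc).mpr h ((det3_ne_zero_iff _ _ _).mp hd)
  have hG : ∀ (i : Fin 4) (P : Fin 6 → Fin 3 → ℂ), G34 v i P = 0 := fun i P =>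
    G34_eq_zero v i P
      (fun c => hline _ _ _ (by revert c; decide))
      (fun r c c' c'' => hline _ _ _ (by revert r c c' c''; decide))
      (fun r => by
        rw [det3_ne_zero_iff, ← not_not (a := LinearIndependent _ _),
          htriples _ _ _ (by revert i; decide) (by revert i r; decide) (by revert i r; decide)]
        revert i r
        decide)
  exact ⟨hG, fun P => (G34c1_eq_G34 v P).trans (hG 0 P)⟩
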